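/- arXiv:2101.07629 — 8 statements merged into one kernel-verified Lean document; each statement's English description precedes it below -/
import Mathlib

section
/- Let δ ≥ 2 and s ∈ {1,…,n} be integers with r := d_s − δ + 1 ≥ 1, and assume n ≥ 2. Then the (δ,s)-quasi affine cartesian code D_X^{(δ,s)}(d) is (r,δ)-locally recoverable: for every coordinate position (i.e. every point α ∈ X) there is a set S_α of coordinate positions containing α with |S_α| = r + δ − 1 = d_s such that the punctured code obtained by restricting D_X^{(δ,s)}(d) to the coordinates in S_α has minimum distance at least δ. (One may take S_α to be the set of points of X agreeing with α in all coordinates except possibly the s-th.) -/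
namespace QACC

open MvPolynomial

noncomputable section

variable {F : Type} [Field F] [Fintype F] [DecidableEq F]

/-- The points of the cartesian set `X = K 0 × ⋯ × K (n-1)`, as a subtype. -/
abbrev cartPoint {n : ℕ} (K : Fin n → Set F) : Type _ :=
  {α : Fin n → F // ∀ i, α i ∈ K i}

noncomputable instance {n : ℕ} (K : Fin n → Set F) : Fintype (cartPoint K) :=
  Fintype.ofFinite _

/-- The evaluation linear map `Ψ` sending a polynomial to its vector of values at points of X. -/
def evalX {n : ℕ} (K : Fin n → Set F) :
    MvPolynomial (Fin n) F →ₗ[F] (cartPoint K → F) where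
  toFun f := fun x => eval x.1 f
  map_add' f g := by funext x; simp
  map_smul' c f := by funext x; simp

/-- The affine cartesian code `C_X(d)`: evaluations of polynomials of total degree `≤ d`. -/
def cartCode {n : ℕ} (K : Fin n → Set F) (d : ℕ) : Submodule F (cartPoint K → F) :=
  (restrictTotalDegree (Fin n) F d).map (evalX K)

/-- The space `P_d^{(δ,s)}` of polynomials of total degree `≤ d` with degree in `X s`
at most `|K s| - δ`. -/
def quasiPoly (n : ℕ) (K : Fin n → Set F) (d δ : ℕ) (s : Fin n) :
    Submodule F (MvPolynomial (Fin n) F) where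
  carrier := {f | f.totalDegree ≤ d ∧ f.degreeOf s ≤ (K s).ncard - δ}
  zero_mem' := by simp
  add_mem' := by
    rintro f g ⟨hf1, hf2⟩ ⟨hg1, hg2⟩
    exact ⟨le_trans (totalDegree_add f g) (max_le hf1 hg1),
      le_trans (degreeOf_add_le s f g) (max_le hf2 hg2)⟩
  smul_mem' := by
    rintro c f ⟨hf1, hf2⟩
    refine ⟨le_trans (totalDegree_smul_le c f) hf1, ?_⟩
    calc (c • f).degreeOf s = (C c * f).degreeOf s := by rw [smul_eq_C_mul]
      _ ≤ (C c).degreeOf s + f.degreeOf s := degreeOf_mul_le s (C c) f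
      _ ≤ (K s).ncard - δ := by simpa [degreeOf_C] using hf2

/-- The `(δ,s)`-quasi affine cartesian code `D_X^{(δ,s)}(d)`. -/
def quasiCode {n : ℕ} (K : Fin n → Set F) (d δ : ℕ) (s : Fin n) :
    Submodule F (cartPoint K → F) :=
  (quasiPoly n K d δ s).map (evalX K)

/-- The minimum distance (minimum Hamming weight of a nonzero codeword) of a linear code. -/
def minDist {ι : Type} [Fintype ι] (C : Submodule F (ι → F)) : ℕ :=
  sInf {w | ∃ v ∈ C, v ≠ 0 ∧ hammingNorm v = w}


/-- The univariate polynomial obtained from `f` by fixing all variables except `s` at `a`. -/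
def restrictLine {n : ℕ} (a : Fin n → F) (s : Fin n) (f : MvPolynomial (Fin n) F) :
    Polynomial F :=
  aeval (Function.update (fun i => Polynomial.C (a i)) s Polynomial.X) f

lemma eval_restrictLine {n : ℕ} (a : Fin n → F) (s : Fin n) (f : MvPolynomial (Fin n) F)
    (b : Fin n → F) (hb : ∀ i, i ≠ s → b i = a i) :
    (restrictLine a s f).eval (b s) = eval b f := by
  have h : ((Polynomial.aeval (b s)).comp
      (aeval (Function.update (fun i => Polynomial.C (a i)) s Polynomial.X)) :
        MvPolynomial (Fin n) F →ₐ[F] F) = aeval b := by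
    ext i
    by_cases hi : i = s
    · subst hi; simp
    · simp [Function.update_of_ne hi, hb i hi]
  simpa [restrictLine, Polynomial.coe_aeval_eq_eval, coe_aeval_eq_eval] using
    DFunLike.congr_fun h f

lemma natDegree_restrictLine_le {n : ℕ} (a : Fin n → F) (s : Fin n)
    (f : MvPolynomial (Fin n) F) : (restrictLine a s f).natDegree ≤ f.degreeOf s := by
  rw [restrictLine, aeval_def, eval₂_eq']
  refine Polynomial.natDegree_sum_le_of_forall_le _ _ fun m hm => ?_
  refine (Polynomial.natDegree_C_mul_le _ _).trans ?_
  rw [← Finset.mul_prod_erase _ _ (Finset.mem_univ s)]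
  have h : ∏ i ∈ Finset.univ.erase s,
      Function.update (fun i => Polynomial.C (a i)) s Polynomial.X i ^ m i =
      Polynomial.C (∏ i ∈ Finset.univ.erase s, a i ^ m i) := by
    rw [map_prod]
    refine Finset.prod_congr rfl fun i hi => ?_
    simp [Function.update_of_ne (Finset.ne_of_mem_erase hi)]
  rw [h, Function.update_self]
  refine (Polynomial.natDegree_mul_C_le _ _).trans ?_
  rw [Polynomial.natDegree_X_pow]
  exact monomial_le_degreeOf s hm

/-- The points of `X` agreeing with `α` outside the coordinate `s` are parametrised by `K s`. -/
def lineEquiv {n : ℕ} (K : Fin n → Set F) (s : Fin n) (α : cartPoint K) :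
    {β : cartPoint K // ∀ i, i ≠ s → β.1 i = α.1 i} ≃ K s where
  toFun β := ⟨β.1.1 s, β.1.2 s⟩
  invFun t := ⟨⟨Function.update α.1 s t, fun i => by
      by_cases hi : i = s
      · subst hi; simp
      · simpa [Function.update_of_ne hi] using α.2 i⟩,
    fun i hi => by simp [Function.update_of_ne hi]⟩
  left_inv β := by
    ext i
    by_cases hi : i = s
    · subst hi; simp
    · simp [Function.update_of_ne hi, β.2 i hi]
  right_inv t := by simp

/-- the quasi affine cartesian code is (r,δ)-locally recoverable with
r = d_s - δ + 1: for every point of X there is a recovery set of size r + δ - 1 = d_s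
such that the punctured code has minimum distance at least δ. -/
theorem quasiCode_locally_recoverable
    (n : ℕ) (hn : 2 ≤ n) (K : Fin n → Set F) (hK : ∀ i, 2 ≤ (K i).ncard)
    (d δ : ℕ) (hδ : 2 ≤ δ) (s : Fin n) (hr : 1 ≤ (K s).ncard - δ + 1 ∧ δ ≤ (K s).ncard) :
    ∀ α : cartPoint K, ∃ S : Finset (cartPoint K),
      α ∈ S ∧ S.card = ((K s).ncard - δ + 1) + δ - 1 ∧
      (S : Set (cartPoint K)) = {β : cartPoint K | ∀ i, i ≠ s → β.1 i = α.1 i} ∧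
      ∀ v ∈ quasiCode K d δ s,
        (fun x : {y // y ∈ S} => v x.1) ≠ 0 →
        δ ≤ hammingNorm (fun x : {y // y ∈ S} => v x.1) := by
  classical
  intro α
  set S : Finset (cartPoint K) :=
    Finset.univ.filter fun β => ∀ i, i ≠ s → β.1 i = α.1 i with hS
  have mem_S {β : cartPoint K} : β ∈ S ↔ ∀ i, i ≠ s → β.1 i = α.1 i := by simp [hS]
  have card_S : S.card = (K s).ncard := by
    rw [hS, ← Fintype.card_subtype, ← Nat.card_eq_fintype_card,
      Nat.card_congr (lineEquiv K s α), Nat.card_coe_set_eq]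
  refine ⟨S, mem_S.2 fun _ _ => rfl, by omega, by ext β; exact mem_S, ?_⟩
  rintro v ⟨f, ⟨-, hf⟩, rfl⟩ hv
  set p := restrictLine α.1 s f
  have heval (x : {y // y ∈ S}) : p.eval (x.1.1 s) = evalX K f x.1 :=
    eval_restrictLine α.1 s f x.1.1 (mem_S.1 x.2)
  have hp : p ≠ 0 := by
    intro h
    refine hv (funext fun x => ?_)
    simp [← heval, h]
  have hzeros : (Finset.univ.filter fun x : {y // y ∈ S} => evalX K f x.1 = 0).card ≤
      (K s).ncard - δ := by
    refine le_trans ?_ ((Polynomial.card_roots' p).trans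
      ((natDegree_restrictLine_le α.1 s f).trans hf))
    refine le_trans (Finset.card_le_card_of_injOn (t := p.roots.toFinset)
      (fun x => x.1.1 s) ?_ ?_) (Multiset.toFinset_card_le _)
    · intro x hx
      have hx' : evalX K f x.1 = 0 := by simpa using hx
      simp [hp, heval, hx']
    · intro x _ y _ hxy
      ext i
      by_cases hi : i = s
      · subst hi; exact hxy
      · rw [mem_S.1 x.2 i hi, mem_S.1 y.2 i hi]
  have hsplit := Finset.card_filter_add_card_filter_not
    (s := (Finset.univ : Finset {y // y ∈ S})) (fun x => evalX K f x.1 = 0)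
  rw [Finset.card_univ, Fintype.card_coe, card_S] at hsplit
  have hδs := hr.2
  change δ ≤ (Finset.univ.filter fun x : {y // y ∈ S} => evalX K f x.1 ≠ 0).card
  simp only [ne_eq]
  omega

end
end QACC
end

section
/- For integers d ≥ 0, δ ≥ 2 and s ∈ {1,…,n} with d_s − δ + 1 ≥ 1, the dimension of D_X^{(δ,s)}(d) as an F_q-vector space equals the number of tuples (a_1,…,a_n) ∈ ℕ^n satisfying 0 ≤ a_i ≤ d_i − 1 for all i, a_s ≤ d_s − δ, and a_1 + ⋯ + a_n ≤ d. -/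
namespace QACC

open MvPolynomial

noncomputable section

variable {F : Type} [Field F] [Fintype F] [DecidableEq F]

/-- The evaluation vector of the monomial with exponent tuple `a` on the cartesian set. -/
def monomialVec {n : ℕ} (K : Fin n → Set F) (a : Fin n → ℕ) : cartPoint K → F :=
  fun x => ∏ i, x.1 i ^ a i

/-- Exponent tuples of the monomials spanning the quasi affine cartesian code. -/
def quasiExponents {n : ℕ} (K : Fin n → Set F) (d δ : ℕ) (s : Fin n) : Set (Fin n → ℕ) :=
  {a | (∀ i, a i ≤ (K i).ncard - 1) ∧ a s ≤ (K s).ncard - δ ∧ ∑ i, a i ≤ d}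

lemma evalX_monomial {n : ℕ} (K : Fin n → Set F) (m : Fin n →₀ ℕ) (c : F) :
    evalX K (monomial m c) = c • monomialVec K m := by
  funext x
  simp [evalX, monomialVec, eval_monomial, Finsupp.prod_fintype]

lemma finite_quasiExponents {n : ℕ} (K : Fin n → Set F) (d δ : ℕ) (s : Fin n) :
    (quasiExponents K d δ s).Finite :=
  (Set.finite_Iic fun i => (K i).ncard - 1).subset fun _ ha => ha.1

lemma linearIndependent_monomialVec {n : ℕ} (K : Fin n → Set F) (T : Set (Fin n → ℕ))
    (hT : ∀ a ∈ T, ∀ i, a i < (K i).ncard) :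
    LinearIndependent F (fun a : T => monomialVec K a.1) := by
  rw [linearIndependent_iff']
  intro t g hg a ha
  set e : T → (Fin n →₀ ℕ) := fun b => Finsupp.equivFunOnFinite.symm b.1 with he
  have he_inj : Function.Injective e :=
    Finsupp.equivFunOnFinite.symm.injective.comp Subtype.val_injective
  set p : MvPolynomial (Fin n) F := ∑ b ∈ t, monomial (e b) (g b) with hp
  have heval : evalX K p = 0 := by
    rw [hp, map_sum, ← hg]
    refine Finset.sum_congr rfl fun b _ => ?_
    rw [evalX_monomial]
    rfl
  have hp0 : p = 0 := by
    refine eq_zero_of_eval_zero_at_prod_finset p (fun i => (Set.toFinite (K i)).toFinset) ?_ ?_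
    · intro i
      rw [← Set.ncard_eq_toFinset_card]
      have hpos : 0 < (K i).ncard := (Nat.zero_le _).trans_lt (hT a.1 a.2 i)
      rw [degreeOf_lt_iff hpos]
      intro m hm
      obtain ⟨b, -, hb⟩ := Finset.mem_biUnion.mp (support_sum hm)
      rw [Finset.mem_singleton.mp (support_monomial_subset hb)]
      exact hT b.1 b.2 i
    · intro x hx
      exact congrFun heval ⟨x, fun i => by simpa using hx i⟩
  have hcoeff := congrArg (coeff (e a)) hp0
  simpa [hp, coeff_sum, coeff_monomial, he_inj.eq_iff, ha] using hcoeff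

/-- On a finite set of size `k`, the `k`-th power is a combination of lower powers. -/
lemma exists_pow_ncard_eq_sum (S : Set F) :
    ∃ c : ℕ → F, ∀ x ∈ S, x ^ S.ncard = ∑ j ∈ Finset.range S.ncard, c j * x ^ j := by
  set t := (Set.toFinite S).toFinset with ht
  set P : Polynomial F := ∏ y ∈ t, (Polynomial.X - Polynomial.C y) with hP
  have hmonic : P.Monic := Polynomial.monic_prod_of_monic _ _ fun y _ => Polynomial.monic_X_sub_C y
  have hdeg : P.natDegree = S.ncard := by
    rw [hP, Polynomial.natDegree_finsetProd_X_sub_C_eq_card, Set.ncard_eq_toFinset_card S]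
  refine ⟨fun j => -P.coeff j, fun x hx => ?_⟩
  have h0 : P.eval x = 0 := by
    rw [hP, Polynomial.eval_prod]
    exact Finset.prod_eq_zero (i := x) (by simpa [ht] using hx) (by simp)
  rw [Polynomial.eval_eq_sum_range, Finset.sum_range_succ, hmonic.coeff_natDegree, hdeg] at h0
  simp only [neg_mul, Finset.sum_neg_distrib]
  linear_combination h0

lemma monomialVec_mem_span {n : ℕ} (K : Fin n → Set F) (hK : ∀ i, 0 < (K i).ncard)
    (d δ : ℕ) (s : Fin n) (a : Fin n → ℕ) (hs : a s ≤ (K s).ncard - δ) (hd : ∑ i, a i ≤ d) :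
    monomialVec K a ∈ Submodule.span F (monomialVec K '' quasiExponents K d δ s) := by
  induction hN : ∑ i, a i using Nat.strong_induction_on generalizing a with
  | _ N ih =>
    by_cases h : ∀ i, a i ≤ (K i).ncard - 1
    · exact Submodule.subset_span ⟨a, ⟨h, hs, hd⟩, rfl⟩
    push Not at h
    obtain ⟨i, hi⟩ := h
    have hKi := hK i
    obtain ⟨c, hc⟩ := exists_pow_ncard_eq_sum (K i)
    have hprod (b : ℕ) (x : cartPoint K) : monomialVec K (Function.update a i b) x =
        x.1 i ^ b * ∏ k ∈ Finset.univ.erase i, x.1 k ^ a k := by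
      rw [monomialVec, ← Finset.mul_prod_erase _ _ (Finset.mem_univ i), Function.update_self]
      congr 1
      exact Finset.prod_congr rfl fun k hk => by
        rw [Function.update_of_ne (Finset.ne_of_mem_erase hk)]
    have hred : monomialVec K a = ∑ j ∈ Finset.range (K i).ncard,
        c j • monomialVec K (Function.update a i (a i - (K i).ncard + j)) := by
      funext x
      rw [Finset.sum_apply]
      simp only [Pi.smul_apply, hprod, smul_eq_mul]
      have hx := hprod (a i) x
      rw [Function.update_eq_self] at hx
      have hsplit : x.1 i ^ a i = x.1 i ^ (a i - (K i).ncard) * x.1 i ^ (K i).ncard := by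
        rw [← pow_add]
        congr 1
        omega
      rw [hx, hsplit, hc _ (x.2 i), Finset.mul_sum, Finset.sum_mul]
      exact Finset.sum_congr rfl fun j _ => by ring
    rw [hred]
    refine Submodule.sum_mem _ fun j hj => Submodule.smul_mem _ _ ?_
    have hj := Finset.mem_range.mp hj
    have hlt : Function.update a i (a i - (K i).ncard + j) < a :=
      update_lt_self_iff.mpr (by omega)
    have hsum := Fintype.sum_strictMono hlt
    exact ih _ (hN ▸ hsum) _ ((hlt.le s).trans hs) (hsum.le.trans hd) rfl

lemma quasiCode_eq_span {n : ℕ} (K : Fin n → Set F) (hK : ∀ i, 0 < (K i).ncard)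
    (d δ : ℕ) (s : Fin n) :
    quasiCode K d δ s = Submodule.span F (monomialVec K '' quasiExponents K d δ s) := by
  apply le_antisymm
  · rintro _ ⟨f, ⟨hfd, hfs⟩, rfl⟩
    rw [f.as_sum, map_sum]
    refine Submodule.sum_mem _ fun m hm => ?_
    rw [evalX_monomial]
    refine Submodule.smul_mem _ _ (monomialVec_mem_span K hK d δ s m ?_ ?_)
    · exact (degreeOf_le_iff.mp hfs) m hm
    · refine le_trans ?_ ((le_totalDegree hm).trans hfd)
      rw [Finsupp.sum_fintype _ _ fun _ => rfl]
  · rw [Submodule.span_le]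
    rintro _ ⟨a, ⟨-, has, had⟩, rfl⟩
    refine ⟨monomial (Finsupp.equivFunOnFinite.symm a) 1, ⟨?_, ?_⟩, ?_⟩
    · rw [totalDegree_monomial _ one_ne_zero, Finsupp.sum_fintype _ _ fun _ => rfl]
      exact had
    · rw [degreeOf_monomial_eq _ _ one_ne_zero]
      exact has
    · rw [evalX_monomial, one_smul]
      rfl

/-- the dimension of the quasi affine cartesian code equals the number of
exponent tuples a with a i ≤ d_i - 1, a s ≤ d_s - δ and ∑ a i ≤ d. -/
theorem dim_quasiCode_eq_card_tuples
    (n : ℕ) (K : Fin n → Set F) (hK : ∀ i, 2 ≤ (K i).ncard)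
    (d δ : ℕ) (hδ : 2 ≤ δ) (s : Fin n) (hr : 1 ≤ (K s).ncard - δ + 1 ∧ δ ≤ (K s).ncard) :
    Module.finrank F ↥(quasiCode K d δ s) =
      Set.ncard {a : Fin n → ℕ |
        (∀ i, a i ≤ (K i).ncard - 1) ∧ a s ≤ (K s).ncard - δ ∧ ∑ i, a i ≤ d} := by
  have hpos (i : Fin n) : 0 < (K i).ncard := two_pos.trans_le (hK i)
  have hind : LinearIndependent F fun a : quasiExponents K d δ s => monomialVec K a.1 :=
    linearIndependent_monomialVec K _ fun a ha i =>
      (ha.1 i).trans_lt (Nat.sub_lt (hpos i) one_pos)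
  have : Fintype (quasiExponents K d δ s) := (finite_quasiExponents K d δ s).fintype
  have hcard := finrank_span_eq_card hind
  rw [← Nat.card_eq_fintype_card, Nat.card_coe_set_eq, ← Set.image_eq_range] at hcard
  rw [quasiCode_eq_span K hpos, hcard]
  rfl

end
end QACC
end

section
/- Let d̃ := ∑_{i ≠ s}(d_i − 1) + d_s − δ. If d ≥ d̃ then D_X^{(δ,s)}(d) = D_X^{(δ,s)}(d̃) (as subspaces of F_q^m). -/
namespace QACC

open MvPolynomial

noncomputable section

variable {F : Type} [Field F] [Fintype F] [DecidableEq F]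

theorem totalDegree_aeval_X_le {σ R : Type*} [CommSemiring R] (i : σ) (p : Polynomial R) :
    (Polynomial.aeval (X i : MvPolynomial σ R) p).totalDegree ≤ p.natDegree := by
  rw [Polynomial.aeval_eq_sum_range]
  refine totalDegree_finsetSum_le fun k hk => (totalDegree_smul_le _ _).trans ?_
  rw [X_pow_eq_monomial]
  refine (totalDegree_monomial_le _ _).trans ?_
  simpa [Nat.lt_succ_iff] using hk

theorem degreeOf_aeval_X_of_ne {σ R : Type*} [CommSemiring R] {i j : σ} (h : i ≠ j)
    (p : Polynomial R) :
    (Polynomial.aeval (X i : MvPolynomial σ R) p).degreeOf j = 0 := by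
  classical
  rw [Polynomial.aeval_eq_sum_range, ← Nat.le_zero]
  refine (degreeOf_sum_le j _ _).trans (Finset.sup_le fun k _ => ?_)
  rw [smul_eq_C_mul]
  exact (degreeOf_C_mul_le _ _ _).trans (degreeOf_X_pow_of_ne k h.symm).le

theorem eval_aeval_X {σ R : Type*} [CommSemiring R] (i : σ) (p : Polynomial R) (x : σ → R) :
    eval x (Polynomial.aeval (X i : MvPolynomial σ R) p) = p.eval (x i) := by
  simp [Polynomial.aeval_eq_sum_range, Polynomial.eval_eq_sum_range, smul_eval]

/-- Every power function on a nonempty finite set `S` is given by a polynomial of degree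
at most `#S - 1` which does not exceed the exponent. -/
theorem exists_natDegree_le_eval_eq_pow {R : Type*} [Field R] (S : Finset R)
    (hS : S.Nonempty) (k : ℕ) :
    ∃ p : Polynomial R, p.natDegree ≤ S.card - 1 ∧ p.natDegree ≤ k ∧
      ∀ x ∈ S, p.eval x = x ^ k := by
  by_cases hk : k ≤ S.card - 1
  · exact ⟨Polynomial.X ^ k, by simpa using hk, by simp, by simp⟩
  have hm : (∏ a ∈ S, (Polynomial.X - Polynomial.C a)).Monic :=
    Polynomial.monic_prod_X_sub_C id S
  have hdeg : (∏ a ∈ S, (Polynomial.X - Polynomial.C a)).natDegree = S.card :=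
    Polynomial.natDegree_finsetProd_X_sub_C_eq_card S id
  have hlt := Polynomial.natDegree_modByMonic_lt (Polynomial.X ^ k) hm (by
    intro h
    rw [h, Polynomial.natDegree_one] at hdeg
    exact hS.card_pos.ne hdeg)
  rw [hdeg] at hlt
  refine ⟨_, Nat.le_pred_of_lt hlt, by omega, fun x hx => ?_⟩
  have hroot : (∏ a ∈ S, (Polynomial.X - Polynomial.C a)).eval x = 0 := by
    simpa [Polynomial.eval_prod, Finset.prod_eq_zero_iff, sub_eq_zero] using hx
  have h := congrArg (Polynomial.eval x) (Polynomial.modByMonic_add_div (Polynomial.X ^ k)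
    (∏ a ∈ S, (Polynomial.X - Polynomial.C a)))
  simpa only [Polynomial.eval_add, Polynomial.eval_mul, hroot, zero_mul, add_zero,
    Polynomial.eval_pow, Polynomial.eval_X] using h

theorem evalX_monomial_mem_quasiCode
    {n : ℕ} {K : Fin n → Set F} (hK : ∀ i, (K i).Nonempty) {δ : ℕ} {s : Fin n}
    {m : Fin n →₀ ℕ} (hm : m s ≤ (K s).ncard - δ) (c : F) :
    evalX K (monomial m c) ∈ quasiCode K
      ((∑ i ∈ Finset.univ.erase s, ((K i).ncard - 1)) + ((K s).ncard - δ)) δ s := by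
  classical
  have h (i : Fin n) : ∃ p : Polynomial F, p.natDegree ≤ (K i).ncard - 1 ∧
      p.natDegree ≤ m i ∧ ∀ x ∈ K i, p.eval x = x ^ m i := by
    have := exists_natDegree_le_eval_eq_pow (K i).toFinset (Set.toFinset_nonempty.2 (hK i)) (m i)
    simpa [Set.ncard_eq_toFinset_card'] using this
  choose p hp1 hp2 hp3 using h
  have hmem : (∏ i, Polynomial.aeval (X i : MvPolynomial (Fin n) F) (p i)) ∈ quasiPoly n K
      ((∑ i ∈ Finset.univ.erase s, ((K i).ncard - 1)) + ((K s).ncard - δ)) δ s := by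
    constructor
    · refine (totalDegree_finsetProd _ _).trans ?_
      rw [← Finset.sum_erase_add _ _ (Finset.mem_univ s)]
      exact Nat.add_le_add
        (Finset.sum_le_sum fun i _ => (totalDegree_aeval_X_le i _).trans (hp1 i))
        ((totalDegree_aeval_X_le s _).trans ((hp2 s).trans hm))
    · refine (degreeOf_prod_le s _ _).trans ?_
      rw [Finset.sum_eq_single s (fun i _ hi => degreeOf_aeval_X_of_ne hi _) (by simp)]
      exact (degreeOf_le_totalDegree _ _).trans
        ((totalDegree_aeval_X_le s _).trans ((hp2 s).trans hm))
  refine ⟨_, Submodule.smul_mem _ c hmem, funext fun x => ?_⟩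
  have hx (i : Fin n) : (p i).eval (x.1 i) = x.1 i ^ m i := hp3 i _ (x.2 i)
  simp [evalX, eval_aeval_X, hx, eval_monomial, Finsupp.prod_fintype]

/-- for d ≥ d̃ = ∑_{i ≠ s}(d_i - 1) + d_s - δ, the code D_X^{(δ,s)}(d)
equals D_X^{(δ,s)}(d̃). -/
theorem quasiCode_stabilizes
    (n : ℕ) (K : Fin n → Set F) (hK : ∀ i, 2 ≤ (K i).ncard)
    (δ : ℕ) (hδ : 2 ≤ δ) (s : Fin n) (hr : δ ≤ (K s).ncard)
    (dt : ℕ) (hdt : dt = (∑ i ∈ Finset.univ.erase s, ((K i).ncard - 1)) + ((K s).ncard - δ))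
    (d : ℕ) (hd : dt ≤ d) :
    quasiCode K d δ s = quasiCode K dt δ s := by
  subst hdt
  have hne (i : Fin n) : (K i).Nonempty :=
    Set.nonempty_of_ncard_ne_zero (by have := hK i; omega)
  apply le_antisymm
  · rintro _ ⟨f, ⟨-, hf⟩, rfl⟩
    rw [f.as_sum, map_sum]
    exact Submodule.sum_mem _ fun m hm =>
      evalX_monomial_mem_quasiCode hne ((monomial_le_degreeOf s hm).trans hf) _
  · exact Submodule.map_mono fun f hf => ⟨hf.1.trans hd, hf.2⟩

end
end QACC
end

section
/- Let d̃ := ∑_{i ≠ s}(d_i − 1) + d_s − δ, and assume d̃ ≥ 1. Then dim_{F_q} D_X^{(δ,s)}(d̃ − 1) = dim_{F_q} D_X^{(δ,s)}(d̃) − 1. -/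
namespace QACC

open MvPolynomial

noncomputable section

variable {F : Type} [Field F] [Fintype F] [DecidableEq F]

theorem monomial_mem_quasiPoly {n : ℕ} {K : Fin n → Set F} {d δ : ℕ} {s : Fin n}
    {m : Fin n →₀ ℕ} (a : F) (hm : m.degree ≤ d) (hs : m s ≤ (K s).ncard - δ) :
    monomial m a ∈ quasiPoly n K d δ s := by
  by_cases ha : a = 0
  · simp [ha]
  · refine ⟨?_, ?_⟩
    · rw [totalDegree_monomial _ ha]
      exact hm
    · rwa [degreeOf_monomial_eq _ _ ha]

theorem monomial_evalX_mem_quasiCode {n : ℕ} {K : Fin n → Set F} {d δ : ℕ} {s : Fin n}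
    {m : Fin n →₀ ℕ} (a : F) (hm : m.degree ≤ d) (hs : m s ≤ (K s).ncard - δ) :
    evalX K (monomial m a) ∈ quasiCode K d δ s :=
  Submodule.mem_map_of_mem (monomial_mem_quasiPoly a hm hs)

theorem quasiCode_mono {n : ℕ} (K : Fin n → Set F) {d d' : ℕ} (h : d ≤ d') (δ : ℕ) (s : Fin n) :
    quasiCode K d δ s ≤ quasiCode K d' δ s :=
  Submodule.map_mono fun _ hf => ⟨hf.1.trans h, hf.2⟩

/-- On a finite set of size `d`, the `d`-th power is a combination of the lower powers. -/
theorem exists_pow_card_eq_sum (S : Finset F) :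
    ∃ r : ℕ → F, ∀ c ∈ S, c ^ S.card = ∑ k ∈ Finset.range S.card, r k * c ^ k := by
  set p : Polynomial F := ∏ c ∈ S, (Polynomial.X - Polynomial.C c) with hp
  have hmonic : p.Monic := Polynomial.monic_prod_of_monic _ _ fun c _ => Polynomial.monic_X_sub_C c
  have hdeg : p.natDegree = S.card := by
    rw [hp, Polynomial.natDegree_prod_of_monic _ _ fun c _ => Polynomial.monic_X_sub_C c]
    simp
  refine ⟨fun k => -p.coeff k, fun c hc => ?_⟩
  have h0 : p.eval c = 0 := by
    rw [hp, Polynomial.eval_prod]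
    exact Finset.prod_eq_zero hc (by simp)
  rw [Polynomial.eval_eq_sum_range, Finset.sum_range_succ, hmonic.coeff_natDegree, hdeg] at h0
  simp only [neg_mul, Finset.sum_neg_distrib]
  linear_combination h0

/-- A monomial having exponent at least `|K i|` in some variable `X i` with `i ≠ s` takes the same
values on the cartesian set as a polynomial of smaller total degree. -/
theorem monomial_evalX_mem_quasiCode_of_ncard_le {n : ℕ} {K : Fin n → Set F} {d δ : ℕ}
    {s i : Fin n} {m : Fin n →₀ ℕ} (a : F) (hm : m.degree ≤ d + 1)
    (hs : m s ≤ (K s).ncard - δ) (his : i ≠ s) (hi : (K i).ncard ≤ m i) :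
    evalX K (monomial m a) ∈ quasiCode K d δ s := by
  classical
  obtain ⟨r, hr⟩ := exists_pow_card_eq_sum (K i).toFinite.toFinset
  rw [← Set.ncard_eq_toFinset_card] at hr
  set m' : Fin n →₀ ℕ := m - Finsupp.single i (K i).ncard with hm'
  have hmm' : m = m' + Finsupp.single i (K i).ncard :=
    (tsub_add_cancel_of_le (by simpa using hi)).symm
  have heval : evalX K (monomial m a) = ∑ k ∈ Finset.range (K i).ncard,
      evalX K (monomial (m' + Finsupp.single i k) (a * r k)) := by
    funext x
    have hx := hr (x.1 i) (by simpa using x.2 i)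
    rw [Finset.sum_apply, hmm']
    simp only [evalX, LinearMap.coe_mk, AddHom.coe_mk]
    have hmon (k : ℕ) (b : F) : eval x.1 (monomial (m' + Finsupp.single i k) b) =
        b * eval x.1 (monomial m' 1) * x.1 i ^ k := by
      rw [monomial_add_single]
      simp [eval_monomial]
    simp only [hmon, hx, Finset.mul_sum]
    exact Finset.sum_congr rfl fun k _ => by ring
  rw [heval]
  refine Submodule.sum_mem _ fun k hk => monomial_evalX_mem_quasiCode _ ?_ ?_
  · rw [hmm'] at hm
    simp only [map_add, Finsupp.degree_single] at hm ⊢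
    have := Finset.mem_range.mp hk
    omega
  · simpa [hm', his] using hs

/-- The largest exponent vector with entries at most `|K i| - 1` for `i ≠ s` and `|K s| - δ` at
`s`. -/
def topExponent {n : ℕ} (K : Fin n → Set F) (δ : ℕ) (s : Fin n) : Fin n →₀ ℕ :=
  Finsupp.equivFunOnFinite.symm fun i => if i = s then (K s).ncard - δ else (K i).ncard - 1

theorem degree_topExponent {n : ℕ} (K : Fin n → Set F) (δ : ℕ) (s : Fin n) :
    (topExponent K δ s).degree =
      (∑ i ∈ Finset.univ.erase s, ((K i).ncard - 1)) + ((K s).ncard - δ) := by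
  rw [Finsupp.degree_eq_sum, ← Finset.sum_erase_add _ _ (Finset.mem_univ s)]
  congr 1
  · exact Finset.sum_congr rfl fun i hi => by simp [topExponent, Finset.ne_of_mem_erase hi]
  · simp [topExponent]

theorem evalX_topExponent_notMem {n : ℕ} {K : Fin n → Set F} (hK : ∀ i, 1 ≤ (K i).ncard)
    {δ : ℕ} (hδ : 1 ≤ δ) {s : Fin n} {d : ℕ} (hd : d < (topExponent K δ s).degree) :
    evalX K (monomial (topExponent K δ s) 1) ∉ quasiCode K d δ s := by
  rintro ⟨g, ⟨hg, -⟩, hgv⟩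
  set e := topExponent K δ s with he
  have hge : coeff e g = 0 := by
    by_contra h
    exact absurd (le_totalDegree (mem_support_iff.mpr h)) (not_le.mpr (hg.trans_lt hd))
  have hcoeff : coeff e (monomial e 1 - g) = (1 : F) := by simp [hge]
  have htot : (monomial e 1 - g : MvPolynomial (Fin n) F).totalDegree = e.degree := by
    refine le_antisymm ((totalDegree_sub _ _).trans (max_le ?_ (hg.trans hd.le))) ?_
    · exact (totalDegree_monomial _ one_ne_zero).le
    · exact le_totalDegree (mem_support_iff.mpr (by simp [hcoeff]))
  obtain ⟨x, hx, hne⟩ := combinatorial_nullstellensatz_exists_eval_nonzero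
    (monomial e 1 - g : MvPolynomial (Fin n) F) e (by simp [hcoeff]) htot
    (fun i => (K i).toFinite.toFinset) (fun i => by
      rw [← Set.ncard_eq_toFinset_card]
      have := hK i
      have := hK s
      by_cases h : i = s
      · subst h
        simp [he, topExponent]
        omega
      · simp [he, topExponent, h]
        omega)
  have := congrFun hgv ⟨x, fun i => by simpa using hx i⟩
  simp only [evalX, LinearMap.coe_mk, AddHom.coe_mk] at this
  exact hne (by rw [map_sub, this, sub_self])

theorem quasiCode_eq_sup_span {n : ℕ} {K : Fin n → Set F} {δ : ℕ} {s : Fin n} {d : ℕ}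
    (hd : (topExponent K δ s).degree = d + 1) :
    quasiCode K (d + 1) δ s =
      quasiCode K d δ s ⊔ Submodule.span F {evalX K (monomial (topExponent K δ s) 1)} := by
  refine le_antisymm ?_ (sup_le (quasiCode_mono K d.le_succ δ s) ?_)
  · rintro _ ⟨f, ⟨hf, hfs⟩, rfl⟩
    rw [f.as_sum, map_sum]
    refine Submodule.sum_mem _ fun m hm => ?_
    have hmd : m.degree ≤ d + 1 := (le_totalDegree hm).trans hf
    have hms : m s ≤ (K s).ncard - δ := (monomial_le_degreeOf s hm).trans hfs
    by_cases hlow : ∃ i ≠ s, (K i).ncard ≤ m i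
    · obtain ⟨i, his, hi⟩ := hlow
      exact Submodule.mem_sup_left (monomial_evalX_mem_quasiCode_of_ncard_le _ hmd hms his hi)
    by_cases hmd' : m.degree ≤ d
    · exact Submodule.mem_sup_left (monomial_evalX_mem_quasiCode _ hmd' hms)
    push Not at hlow
    have hle : m ≤ topExponent K δ s := fun i => by
      by_cases h : i = s
      · subst h
        simpa [topExponent] using hms
      · have := hlow i h
        simp [topExponent, h]
        omega
    have hsub : topExponent K δ s - m = 0 := by
      have := congrArg Finsupp.degree (tsub_add_cancel_of_le hle)
      rw [map_add] at this
      rw [← Finsupp.degree_eq_zero_iff]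
      omega
    have hmeq : m = topExponent K δ s := le_antisymm hle (tsub_eq_zero_iff_le.mp hsub)
    refine Submodule.mem_sup_right (Submodule.mem_span_singleton.mpr ⟨coeff m f, ?_⟩)
    rw [← hmeq, ← map_smul, smul_monomial, smul_eq_mul, mul_one]
  · rw [Submodule.span_singleton_le_iff_mem]
    exact monomial_evalX_mem_quasiCode _ hd.le (by simp [topExponent])

/-- dim D_X^{(δ,s)}(d̃ - 1) = dim D_X^{(δ,s)}(d̃) - 1. -/
theorem dim_quasiCode_at_dtilde_sub_one
    (n : ℕ) (K : Fin n → Set F) (hK : ∀ i, 2 ≤ (K i).ncard)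
    (δ : ℕ) (hδ : 2 ≤ δ) (s : Fin n) (hr : δ ≤ (K s).ncard)
    (dt : ℕ) (hdt : dt = (∑ i ∈ Finset.univ.erase s, ((K i).ncard - 1)) + ((K s).ncard - δ))
    (hdt1 : 1 ≤ dt) :
    Module.finrank F ↥(quasiCode K (dt - 1) δ s) =
      Module.finrank F ↥(quasiCode K dt δ s) - 1 := by
  obtain ⟨d, rfl⟩ : ∃ d, dt = d + 1 := ⟨dt - 1, by omega⟩
  have hdeg : (topExponent K δ s).degree = d + 1 := (degree_topExponent K δ s).trans hdt.symm
  have hnot : evalX K (monomial (topExponent K δ s) 1) ∉ quasiCode K d δ s :=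
    evalX_topExponent_notMem (fun i => one_le_two.trans (hK i)) (one_le_two.trans hδ)
      (by omega)
  rw [quasiCode_eq_sup_span hdeg, Submodule.finrank_sup_span_singleton hnot, Nat.add_sub_cancel,
    Nat.add_sub_cancel]

end
end QACC
end

section
/- Let r := d_s − δ + 1 ≥ 1 and d̃ := ∑_{i ≠ s}(d_i − 1) + d_s − δ. Let X_s := K_1 × ⋯ × K_{s−1} × K_{s+1} × ⋯ × K_n and let C_{X_s}(e) denote the affine cartesian code of order e defined over the sets K_1,…,K_{s−1},K_{s+1},…,K_n. If d is an integer with r ≤ d ≤ d̃, then dim_{F_q} D_X^{(δ,s)}(d) = dim_{F_q} C_X(d) − ∑_{i=0}^{δ−2} dim_{F_q} C_{X_s}(d − r − i), where by convention dim_{F_q} C_{X_s}(e) = 0 when e < 0. -/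
namespace QACC

open MvPolynomial

noncomputable section

variable {F : Type} [Field F] [Fintype F] [DecidableEq F]

omit [DecidableEq F] in
/-- On a finite set of size `N`, the function `x ↦ x ^ k` agrees with a polynomial of degree
less than `N` and at most `k`. -/
lemma exists_pow_eq_sum (S : Set F) (hS : S.Nonempty) (k : ℕ) :
    ∃ c : ℕ → F, ∀ x ∈ S, x ^ k = ∑ j ∈ Finset.range (min (k + 1) S.ncard), c j * x ^ j := by
  classical
  rcases lt_or_ge k S.ncard with hk | hk
  · refine ⟨fun j => if j = k then 1 else 0, fun x _ => ?_⟩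
    rw [min_eq_left hk]
    simp
  · set g : Polynomial F := ∏ a ∈ S.toFinset, (Polynomial.X - Polynomial.C a) with hg
    have hmonic : g.Monic :=
      Polynomial.monic_prod_of_monic _ _ fun a _ => Polynomial.monic_X_sub_C a
    have hdeg : g.natDegree = S.ncard := by
      rw [hg, Polynomial.natDegree_prod_of_monic _ _ fun a _ => Polynomial.monic_X_sub_C a]
      simp [Set.ncard_eq_toFinset_card']
    have hg1 : g ≠ 1 := by
      intro h
      rw [h, Polynomial.natDegree_one] at hdeg
      exact (S.ncard_pos.2 hS).ne hdeg
    refine ⟨(Polynomial.X ^ k %ₘ g).coeff, fun x hx => ?_⟩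
    have hroot : g.eval x = 0 := by
      rw [hg, Polynomial.eval_prod]
      exact Finset.prod_eq_zero (Set.mem_toFinset.2 hx) (by simp)
    rw [min_eq_right (by lia), ← Polynomial.eval_eq_sum_range'
      (hdeg ▸ Polynomial.natDegree_modByMonic_lt _ hmonic hg1)]
    conv_lhs => rw [← Polynomial.eval_X (x := x), ← Polynomial.eval_pow,
      ← Polynomial.modByMonic_add_div (Polynomial.X ^ k) g]
    simp [hroot]

/-- The exponents of the monomials that are reduced with respect to `K` and satisfy `P`. -/
def reducedExponents {n : ℕ} (K : Fin n → Set F) (P : (Fin n → ℕ) → Prop) :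
    Set (Fin n →₀ ℕ) :=
  {a | P a ∧ ∀ i, a i < (K i).ncard}

omit [Fintype F] [DecidableEq F] in
lemma evalX_monomial_s6 {n : ℕ} (K : Fin n → Set F) (a : Fin n →₀ ℕ) (c : F) (x : cartPoint K) :
    evalX K (monomial a c) x = c * ∏ i, x.1 i ^ a i := by
  change eval x.1 (monomial a c) = _
  rw [eval_monomial, Finsupp.prod_fintype _ _ (by simp)]

omit [DecidableEq F] in
/-- If `P` is closed downwards, every polynomial supported on `P` has the same values on the
cartesian set as one that is also reduced. -/
lemma map_evalX_restrictSupport {n : ℕ} (K : Fin n → Set F) (hK : ∀ i, (K i).Nonempty)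
    (P : (Fin n → ℕ) → Prop) (hP : ∀ a b, b ≤ a → P a → P b) :
    (restrictSupport F {a : Fin n →₀ ℕ | P a}).map (evalX K) =
      (restrictSupport F (reducedExponents K P)).map (evalX K) := by
  refine le_antisymm ?_ (Submodule.map_mono (restrictSupport_mono F fun a ha => ha.1))
  rw [restrictSupport_eq_span, Submodule.map_span_le]
  rintro _ ⟨a, ha, rfl⟩
  choose c hc using fun i => exists_pow_eq_sum (K i) (hK i) (a i)
  refine ⟨∑ f ∈ Fintype.piFinset fun i => Finset.range (min (a i + 1) (K i).ncard),
    monomial (Finsupp.equivFunOnFinite.symm f) (∏ i, c i (f i)), ?_, ?_⟩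
  · refine Submodule.sum_mem _ fun f hf => (monomial_mem_restrictSupport F).2 (Or.inl ?_)
    simp only [Fintype.mem_piFinset, Finset.mem_range, lt_min_iff] at hf
    exact ⟨hP _ _ (fun i => Nat.lt_succ_iff.1 (hf i).1) ha, fun i => (hf i).2⟩
  · funext x
    rw [map_sum, Finset.sum_apply, evalX_monomial_s6, one_mul,
      Finset.prod_congr rfl fun i _ => hc i _ (x.2 i), Finset.prod_univ_sum]
    refine Finset.sum_congr rfl fun f _ => ?_
    rw [evalX_monomial_s6, Finset.prod_mul_distrib]
    rfl

omit [DecidableEq F] in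
/-- A reduced polynomial vanishing on the cartesian set is zero. -/
lemma eq_zero_of_evalX_eq_zero {n : ℕ} (K : Fin n → Set F) (hK : ∀ i, (K i).Nonempty)
    (P : (Fin n → ℕ) → Prop) {f : MvPolynomial (Fin n) F}
    (hf : f ∈ restrictSupport F (reducedExponents K P)) (h : evalX K f = 0) : f = 0 := by
  classical
  refine eq_zero_of_eval_zero_at_prod_finset f (fun i => (K i).toFinset) (fun i => ?_)
    fun x hx => ?_
  · rw [degreeOf_eq_sup, ← Set.ncard_eq_toFinset_card',
      Finset.sup_lt_iff ((K i).ncard_pos.2 (hK i))]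
    exact fun a ha => (hf ha).2 i
  · exact congrFun h ⟨x, fun i => Set.mem_toFinset.1 (hx i)⟩

omit [DecidableEq F] in
lemma finrank_map_evalX {n : ℕ} (K : Fin n → Set F) (hK : ∀ i, (K i).Nonempty)
    (P : (Fin n → ℕ) → Prop) [DecidablePred P] (hP : ∀ a b, b ≤ a → P a → P b) :
    Module.finrank F ((restrictSupport F {a : Fin n →₀ ℕ | P a}).map (evalX K)) =
      ((Fintype.piFinset fun i => Finset.range (K i).ncard).filter P).card := by
  rw [map_evalX_restrictSupport K hK P hP, ← LinearMap.range_domRestrict,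
    LinearMap.finrank_range_of_inj, Module.finrank_eq_nat_card_basis (basisRestrictSupport F _),
    ← Nat.card_eq_finsetCard]
  · refine Nat.card_congr (Finsupp.equivFunOnFinite.subtypeEquiv fun a => ?_)
    simp only [reducedExponents, Set.mem_ofPred_eq, Finset.mem_filter, Fintype.mem_piFinset,
      Finset.mem_range]
    exact and_comm
  · rw [← LinearMap.ker_eq_bot, LinearMap.ker_eq_bot']
    rintro ⟨f, hf⟩ h
    exact Subtype.ext (eq_zero_of_evalX_eq_zero K hK P hf h)

omit [DecidableEq F] in
lemma finrank_cartCode {n : ℕ} (K : Fin n → Set F) (hK : ∀ i, (K i).Nonempty) (d : ℕ) :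
    Module.finrank F (cartCode K d) =
      ((Fintype.piFinset fun i => Finset.range (K i).ncard).filter
        fun a => ∑ i, a i ≤ d).card := by
  rw [← finrank_map_evalX K hK _ fun a b hab ha => (Finset.sum_le_sum fun i _ => hab i).trans ha]
  have : restrictTotalDegree (Fin n) F d =
      restrictSupport F {a : Fin n →₀ ℕ | ∑ i, a i ≤ d} := by
    refine congrArg (restrictSupport F) (Set.ext fun a => ?_)
    rw [Set.mem_ofPred_eq, Set.mem_ofPred_eq, Finsupp.sum_fintype _ _ fun _ => rfl]
  rw [cartCode, this]

omit [DecidableEq F] in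
lemma finrank_quasiCode {n : ℕ} (K : Fin n → Set F) (hK : ∀ i, (K i).Nonempty) (d δ : ℕ)
    (s : Fin n) :
    Module.finrank F (quasiCode K d δ s) =
      ((Fintype.piFinset fun i => Finset.range (K i).ncard).filter
        fun a => ∑ i, a i ≤ d ∧ a s ≤ (K s).ncard - δ).card := by
  rw [← finrank_map_evalX K hK _ fun a b hab ha =>
    ⟨(Finset.sum_le_sum fun i _ => hab i).trans ha.1, (hab s).trans ha.2⟩]
  have : quasiPoly n K d δ s = restrictSupport F
      {a : Fin n →₀ ℕ | ∑ i, a i ≤ d ∧ a s ≤ (K s).ncard - δ} := by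
    ext f
    change f.totalDegree ≤ d ∧ f.degreeOf s ≤ (K s).ncard - δ ↔ ∀ a ∈ f.support, _ ∧ _
    rw [totalDegree, Finset.sup_le_iff, degreeOf_le_iff, ← forall₂_and]
    simp only [Finsupp.sum_fintype, implies_true]
  rw [quasiCode, this]

/-- Reduced exponents with a prescribed entry `k` at `s` correspond to exponents in the
remaining variables. -/
lemma card_filter_apply_eq {n : ℕ} (N : Fin (n + 1) → ℕ) (s : Fin (n + 1)) (d k : ℕ)
    (hk : k < N s) :
    ((Fintype.piFinset fun i => Finset.range (N i)).filter
        fun a => ∑ i, a i ≤ d ∧ a s = k).card =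
      if k ≤ d then
        ((Fintype.piFinset fun t => Finset.range (N (s.succAbove t))).filter
          fun b => ∑ t, b t ≤ d - k).card
      else 0 := by
  split_ifs with hkd
  · refine Finset.card_bij' (fun a _ => s.removeNth a) (fun b _ => s.insertNth k b) ?_ ?_ ?_ ?_
    · intro a ha
      simp only [Finset.mem_filter, Fintype.mem_piFinset, Finset.mem_range,
        Fin.sum_univ_succAbove _ s, Fin.removeNth] at ha ⊢
      exact ⟨fun t => ha.1 _, by lia⟩
    · intro b hb
      simp only [Finset.mem_filter, Fintype.mem_piFinset, Finset.mem_range,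
        Fin.sum_univ_succAbove _ s, Fin.forall_iff_succAbove s, Fin.insertNth_apply_same,
        Fin.insertNth_apply_succAbove] at hb ⊢
      exact ⟨⟨hk, hb.1⟩, by lia, trivial⟩
    · intro a ha
      rw [Fin.insertNth_eq_iff]
      exact ⟨(Finset.mem_filter.1 ha).2.2.symm, rfl⟩
    · intro b _
      simp
  · rw [Finset.card_eq_zero, Finset.filter_eq_empty_iff]
    rintro a - ⟨h, rfl⟩
    exact hkd ((Finset.single_le_sum (fun _ _ => Nat.zero_le _) (Finset.mem_univ s)).trans h)

/-- Split the exponents according to whether the entry at `s` is at least `r`. -/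
lemma card_filter_sum_le {ι : Type*} [Fintype ι] [DecidableEq ι] (N : ι → ℕ) (s : ι)
    (d r m : ℕ) (hr : r + m = N s) :
    ((Fintype.piFinset fun i => Finset.range (N i)).filter fun a => ∑ i, a i ≤ d).card =
      ((Fintype.piFinset fun i => Finset.range (N i)).filter
        fun a => ∑ i, a i ≤ d ∧ a s < r).card +
      ∑ i ∈ Finset.range m, ((Fintype.piFinset fun i => Finset.range (N i)).filter
        fun a => ∑ i, a i ≤ d ∧ a s = r + i).card := by
  rw [← Finset.card_filter_add_card_filter_not
    (s := (Fintype.piFinset fun i => Finset.range (N i)).filter fun a => ∑ i, a i ≤ d)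
    (fun a : ι → ℕ => a s < r), Finset.filter_filter, Finset.filter_filter]
  congr 1
  rw [Finset.card_eq_sum_card_fiberwise (f := fun a : ι → ℕ => a s - r) (t := Finset.range m)]
  · refine Finset.sum_congr rfl fun i _ => ?_
    rw [Finset.filter_filter]
    congr 1
    exact Finset.filter_congr fun a _ => by lia
  · intro a ha
    simp only [Finset.coe_filter, Fintype.mem_piFinset, Finset.mem_range,
      Set.mem_ofPred_eq] at ha
    have := ha.1 s
    simp only [Finset.coe_range, Set.mem_Iio]
    lia

/-- for r ≤ d ≤ d̃,
dim D_X^{(δ,s)}(d) = dim C_X(d) - ∑_{i=0}^{δ-2} dim C_{X_s}(d - r - i),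
where C_{X_s} is the cartesian code over the sets K_1,…,K_{s-1},K_{s+1},…,K_n and
dim C_{X_s}(e) = 0 when e < 0.  (Here the number of variables is written as n + 1 so that
deleting the s-th factor leaves n ≥ 1 factors.) -/
theorem dim_quasiCode_formula
    (n : ℕ) (hn : 1 ≤ n) (K : Fin (n + 1) → Set F) (hK : ∀ i, 2 ≤ (K i).ncard)
    (δ : ℕ) (hδ : 2 ≤ δ) (s : Fin (n + 1)) (hδs : δ ≤ (K s).ncard)
    (r : ℕ) (hrdef : r = (K s).ncard - δ + 1)
    (d : ℕ) (hd1 : r ≤ d)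
    (hd2 : d ≤ (∑ i ∈ Finset.univ.erase s, ((K i).ncard - 1)) + ((K s).ncard - δ)) :
    Module.finrank F ↥(quasiCode K d δ s) =
      Module.finrank F ↥(cartCode K d) -
      ∑ i ∈ Finset.range (δ - 1),
        (if r + i ≤ d then
          Module.finrank F ↥(cartCode (fun t => K (s.succAbove t)) (d - r - i))
        else 0) := by
  have hne : ∀ i, (K i).Nonempty := fun i =>
    Set.nonempty_of_ncard_ne_zero (by have := hK i; lia)
  rw [finrank_quasiCode K hne, finrank_cartCode K hne,
    card_filter_sum_le (fun i => (K i).ncard) s d r (δ - 1) (by lia)]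
  refine (Nat.sub_eq_of_eq_add ?_).symm
  congr 1
  · congr 1
    exact Finset.filter_congr fun a _ => by lia
  · refine Finset.sum_congr rfl fun i hi => ?_
    rw [Finset.mem_range] at hi
    rw [card_filter_apply_eq (fun i => (K i).ncard) s d (r + i) (by lia),
      finrank_cartCode _ fun t => hne _, Nat.sub_sub]

end
end QACC
end

section
/- Let r := d_s − δ + 1 ≥ 1 and κ := dim_{F_q} D_X^{(δ,s)}(d). Then W^(1)(C_X(d)) ≤ W^(1)(D_X^{(δ,s)}(d)) ≤ m − κ − (⌈κ/r⌉ − 1)(δ − 1) + 1, where ⌈x⌉ denotes the least integer ≥ x. -/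
namespace QACC

open MvPolynomial

noncomputable section

variable {F : Type} [Field F] [Fintype F] [DecidableEq F]

omit [Fintype F] in
/-- The minimum distance reverses inclusions of nonzero codes. -/
theorem minDist_anti {ι : Type} [Fintype ι] {C D : Submodule F (ι → F)} (h : C ≤ D)
    (hC : C ≠ ⊥) : minDist D ≤ minDist C := by
  obtain ⟨w, hw, hw0⟩ := C.exists_mem_ne_zero_of_ne_bot hC
  obtain ⟨v, hv, hv0, hvw⟩ := Nat.sInf_mem
    (s := {k | ∃ v ∈ C, v ≠ 0 ∧ hammingNorm v = k}) ⟨_, w, hw, hw0, rfl⟩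
  exact Nat.sInf_le ⟨v, h hv, hv0, hvw⟩

omit [Fintype F] [DecidableEq F] in
/-- A code has a nonzero codeword vanishing on any set of fewer than `finrank C` coordinates. -/
theorem exists_ne_zero_of_card_lt_finrank {ι : Type} [Fintype ι] (C : Submodule F (ι → F))
    (I : Finset ι) (hI : I.card < Module.finrank F C) :
    ∃ v ∈ C, v ≠ 0 ∧ ∀ i ∈ I, v i = 0 := by
  let g : C →ₗ[F] (I → F) := (LinearMap.funLeft F F (Subtype.val : I → ι)).comp C.subtype
  have hg : LinearMap.ker g ≠ ⊥ := LinearMap.ker_ne_bot_of_finrank_lt (by simpa using hI)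
  obtain ⟨v, hv, hv0⟩ := (LinearMap.ker g).exists_mem_ne_zero_of_ne_bot hg
  refine ⟨v, v.2, by simpa using hv0, fun i hi => ?_⟩
  exact congrFun (LinearMap.mem_ker.mp hv) ⟨i, hi⟩

omit [Fintype F] in
/-- Singleton-type bound for a code whose coordinates form a grid `J × B`, each column
`J × {b}` of a codeword being zero as soon as it is zero on `A`. -/
theorem minDist_add_le_of_columns {ι J B : Type} [Fintype ι] [Fintype J] [Fintype B]
    (C : Submodule F (ι → F)) (e : ι ≃ J × B) (A : Finset J)
    (hA : 0 < A.card) (hC : 0 < Module.finrank F C)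
    (hcol : ∀ v ∈ C, ∀ b, (∀ a ∈ A, v (e.symm (a, b)) = 0) → ∀ j, v (e.symm (j, b)) = 0) :
    minDist C + ((Module.finrank F C - 1) / A.card * Fintype.card J +
      (Module.finrank F C - 1) % A.card) ≤ Fintype.card ι := by
  classical
  set κ := Module.finrank F C
  set t := (κ - 1) / A.card
  have hdiv : A.card * t + (κ - 1) % A.card = κ - 1 := Nat.div_add_mod _ _
  have hmod : (κ - 1) % A.card < A.card := Nat.mod_lt _ hA
  have hκ : κ ≤ A.card * Fintype.card B := by
    by_contra! hlt
    obtain ⟨v, hv, hv0, hvI⟩ := exists_ne_zero_of_card_lt_finrank C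
      ((A ×ˢ (Finset.univ : Finset B)).map e.symm.toEmbedding)
      (by simpa [Finset.card_product] using hlt)
    refine hv0 (funext fun i => ?_)
    have := hcol v hv (e i).2 (fun a ha => hvI _ (by simpa using ha)) (e i).1
    simpa using this
  have ht : t < Fintype.card B := by
    by_contra! hle
    have := Nat.mul_le_mul_left A.card hle
    omega
  obtain ⟨T, -, hT⟩ := Finset.exists_subset_card_eq (s := (Finset.univ : Finset B)) (n := t)
    (by simpa using ht.le)
  obtain ⟨b, hb⟩ : ∃ b, b ∉ T := by
    by_contra! hall
    rw [Finset.eq_univ_iff_forall.mpr hall, Finset.card_univ] at hT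
    omega
  obtain ⟨A', hA'A, hA'⟩ := Finset.exists_subset_card_eq hmod.le
  obtain ⟨v, hv, hv0, hvI⟩ := exists_ne_zero_of_card_lt_finrank C
    ((A ×ˢ T ∪ A' ×ˢ {b}).map e.symm.toEmbedding) (by
      have := Finset.card_union_le (A ×ˢ T) (A' ×ˢ {b})
      simp only [Finset.card_product, Finset.card_singleton, hT, hA'] at this
      rw [Finset.card_map]
      omega)
  have hS : ∀ p ∈ (Finset.univ : Finset J) ×ˢ T ∪ A' ×ˢ {b}, v (e.symm p) = 0 := by
    rintro ⟨j, c⟩ hp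
    simp only [Finset.mem_union, Finset.mem_product, Finset.mem_univ, true_and,
      Finset.mem_singleton] at hp
    rcases hp with hc | ⟨hj, rfl⟩
    · exact hcol v hv c
        (fun a ha => hvI _ (Finset.mem_map_of_mem _ (by simp [ha, hc]))) j
    · exact hvI _ (Finset.mem_map_of_mem _ (by simp [hj]))
  have hcard : ((Finset.univ : Finset J) ×ˢ T ∪ A' ×ˢ {b}).card =
      t * Fintype.card J + (κ - 1) % A.card := by
    rw [Finset.card_union_of_disjoint, Finset.card_product, Finset.card_product, hT, hA',
      Finset.card_univ, Finset.card_singleton, mul_one, mul_comm]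
    rw [Finset.disjoint_left]
    rintro ⟨j, c⟩ h1 h2
    simp only [Finset.mem_product, Finset.mem_singleton] at h1 h2
    exact hb (h2.2 ▸ h1.2)
  have hw : minDist C ≤ hammingNorm v := Nat.sInf_le ⟨v, hv, hv0, rfl⟩
  have hdisj : Disjoint (Finset.univ.filter fun i => v i ≠ 0)
      (((Finset.univ : Finset J) ×ˢ T ∪ A' ×ˢ {b}).map e.symm.toEmbedding) := by
    rw [Finset.disjoint_left]
    intro i hi hi'
    obtain ⟨p, hp, rfl⟩ := Finset.mem_map.mp hi'
    exact (Finset.mem_filter.mp hi).2 (hS p hp)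
  have := Finset.card_le_univ ((Finset.univ.filter fun i => v i ≠ 0) ∪
      (((Finset.univ : Finset J) ×ˢ T ∪ A' ×ˢ {b}).map e.symm.toEmbedding))
  rw [Finset.card_union_of_disjoint hdisj, Finset.card_map, hcard] at this
  change hammingNorm v + _ ≤ _ at this
  omega

omit [Fintype F] [DecidableEq F] in
/-- Fixing all variables but `X s` gives a univariate polynomial of degree at most the degree
in `X s`. -/
theorem natDegree_aeval_update_le {σ : Type} [DecidableEq σ] (f : MvPolynomial σ F)
    (s : σ) (x : σ → F) :
    (aeval (Function.update (fun i => Polynomial.C (x i)) s Polynomial.X) f).natDegree ≤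
      f.degreeOf s := by
  rw [aeval_def, eval₂_eq]
  refine Polynomial.natDegree_sum_le_of_forall_le _ _ fun u hu => ?_
  refine (Polynomial.natDegree_C_mul_le _ _).trans ((Polynomial.natDegree_prod_le _ _).trans ?_)
  have hterm : ∀ i ∈ u.support, (Function.update (fun i => Polynomial.C (x i)) s
      Polynomial.X i ^ u i).natDegree ≤ if i = s then u s else 0 := by
    intro i _
    by_cases h : i = s
    · subst h
      simp
    · rw [Function.update_of_ne h, if_neg h, ← Polynomial.C_pow, Polynomial.natDegree_C]
  refine (Finset.sum_le_sum hterm).trans ?_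
  rw [Finset.sum_ite_eq']
  split_ifs
  · exact monomial_le_degreeOf s hu
  · exact Nat.zero_le _

omit [Fintype F] [DecidableEq F] in
theorem eval_aeval_update {σ : Type} [DecidableEq σ] (f : MvPolynomial σ F)
    (s : σ) (x : σ → F) (a : F) :
    (aeval (Function.update (fun i => Polynomial.C (x i)) s Polynomial.X) f).eval a =
      eval (Function.update x s a) f := by
  induction f using MvPolynomial.induction_on with
  | C c => simp
  | add p q hp hq => simp [hp, hq]
  | mul_X p i hp =>
    by_cases h : i = s
    · subst h
      simp [hp]
    · simp [hp, h]

omit [Fintype F] [DecidableEq F] in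
/-- A polynomial vanishing at more points of a line in direction `s` than its degree in `X s`
vanishes on the whole line. -/
theorem eval_update_eq_zero {σ : Type} [DecidableEq σ] (f : MvPolynomial σ F)
    (s : σ) (x : σ → F) (A : Finset F) (hA : f.degreeOf s < A.card)
    (h : ∀ a ∈ A, eval (Function.update x s a) f = 0) (c : F) :
    eval (Function.update x s c) f = 0 := by
  rw [← eval_aeval_update, Polynomial.eq_zero_of_natDegree_lt_card_of_eval_eq_zero'
    (aeval (Function.update (fun i => Polynomial.C (x i)) s Polynomial.X) f) A
    (fun a ha => by rw [eval_aeval_update, h a ha])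
    ((natDegree_aeval_update_le f s x).trans_lt hA), Polynomial.eval_zero]

/-- The cartesian set as the product of its `s`-th factor with the others. -/
def cartPointSplit {n : ℕ} (K : Fin n → Set F) (s : Fin n) :
    cartPoint K ≃ K s × ((j : {j // j ≠ s}) → K j) :=
  (Equiv.subtypePiEquivPi (p := fun i a => a ∈ K i)).trans
    (Equiv.piSplitAt s fun i => K i)

omit [Field F] [Fintype F] [DecidableEq F] in
theorem cartPointSplit_symm_val {n : ℕ} (K : Fin n → Set F) (s : Fin n) (a c : K s)
    (b : (j : {j // j ≠ s}) → K j) :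
    ((cartPointSplit K s).symm (c, b)).1 =
      Function.update ((cartPointSplit K s).symm (a, b)).1 s c := by
  funext i
  by_cases h : i = s
  · subst h
    simp [cartPointSplit, Equiv.subtypePiEquivPi, Equiv.piSplitAt]
  · simp [cartPointSplit, Equiv.subtypePiEquivPi, Equiv.piSplitAt, h]

omit [Field F] [DecidableEq F] in
theorem card_cartPoint {n : ℕ} (K : Fin n → Set F) :
    Fintype.card (cartPoint K) = ∏ i, (K i).ncard := by
  rw [← Nat.card_eq_fintype_card,
    Nat.card_congr (Equiv.subtypePiEquivPi (p := fun i a => a ∈ K i)), Nat.card_pi]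
  rfl

omit [Fintype F] [DecidableEq F] in
theorem quasiCode_le_cartCode {n : ℕ} (K : Fin n → Set F) (d δ : ℕ) (s : Fin n) :
    quasiCode K d δ s ≤ cartCode K d :=
  Submodule.map_mono fun f hf => (mem_restrictTotalDegree _ _ f).mpr hf.1

omit [Fintype F] [DecidableEq F] in
theorem quasiCode_ne_bot {n : ℕ} (K : Fin n → Set F) (hK : ∀ i, (K i).Nonempty) (d δ : ℕ)
    (s : Fin n) : quasiCode K d δ s ≠ ⊥ := by
  choose x hx using hK
  have hmem : evalX K 1 ∈ quasiCode K d δ s :=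
    Submodule.mem_map_of_mem (show (1 : MvPolynomial (Fin n) F) ∈ quasiPoly n K d δ s from
      ⟨by simp, by simp [degreeOf_one]⟩)
  intro h
  rw [h, Submodule.mem_bot] at hmem
  have := congrFun hmem ⟨x, hx⟩
  simp [evalX] at this

omit [Fintype F] [DecidableEq F] in
/-- A codeword of the quasi code vanishing at enough points of a line in direction `s` vanishes
on the whole line. -/
theorem quasiCode_column_eq_zero {n : ℕ} (K : Fin n → Set F) (d δ : ℕ) (s : Fin n)
    (A : Finset (K s)) (hA : A.card = (K s).ncard - δ + 1)
    (v : cartPoint K → F) (hv : v ∈ quasiCode K d δ s) (b : (j : {j // j ≠ s}) → K j)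
    (h : ∀ a ∈ A, v ((cartPointSplit K s).symm (a, b)) = 0) (c : K s) :
    v ((cartPointSplit K s).symm (c, b)) = 0 := by
  obtain ⟨f, hf, rfl⟩ := hv
  change eval _ f = 0
  rw [cartPointSplit_symm_val K s c c b]
  refine eval_update_eq_zero f s _ (A.map (Function.Embedding.subtype _)) ?_ ?_ c
  · rw [Finset.card_map, hA]
    exact Nat.lt_succ_of_le hf.2
  · intro a ha
    obtain ⟨a, haA, rfl⟩ := Finset.mem_map.mp ha
    have := h a haA
    change eval _ f = 0 at this
    rwa [cartPointSplit_symm_val K s c a b] at this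

/-- W¹(C_X(d)) ≤ W¹(D_X^{(δ,s)}(d)) ≤ m - κ - (⌈κ/r⌉ - 1)(δ - 1) + 1,
where κ = dim D_X^{(δ,s)}(d), r = d_s - δ + 1 and m = ∏ d_i.
(The ceiling ⌈κ/r⌉ of the rational κ/r is the natural number (κ + r - 1)/r.) -/
theorem minDist_quasiCode_bounds
    (n : ℕ) (hn : 2 ≤ n) (K : Fin n → Set F) (hK : ∀ i, 2 ≤ (K i).ncard)
    (d δ : ℕ) (hδ : 2 ≤ δ) (s : Fin n) (hδs : δ ≤ (K s).ncard)
    (r : ℕ) (hrdef : r = (K s).ncard - δ + 1)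
    (m : ℕ) (hmdef : m = ∏ i, (K i).ncard)
    (κ : ℕ) (hκdef : κ = Module.finrank F ↥(quasiCode K d δ s)) :
    minDist (cartCode K d) ≤ minDist (quasiCode K d δ s) ∧
    (minDist (quasiCode K d δ s) : ℤ) ≤
      (m : ℤ) - (κ : ℤ) - ((((κ + r - 1) / r : ℕ) : ℤ) - 1) * ((δ : ℤ) - 1) + 1 := by
  classical
  have hne : quasiCode K d δ s ≠ ⊥ := quasiCode_ne_bot K
    (fun i => Set.nonempty_of_ncard_ne_zero (by have := hK i; omega)) d δ s
  refine ⟨minDist_anti (quasiCode_le_cartCode K d δ s) hne, ?_⟩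
  have hκ : 0 < κ := by
    rw [hκdef]
    exact Nat.pos_of_ne_zero fun h => hne (Submodule.finrank_eq_zero.mp h)
  have hJ : Fintype.card (K s) = (K s).ncard := by
    rw [← Nat.card_eq_fintype_card]
    rfl
  obtain ⟨A, -, hA⟩ := Finset.exists_subset_card_eq (s := (Finset.univ : Finset (K s)))
    (n := (K s).ncard - δ + 1) (by rw [Finset.card_univ, hJ]; omega)
  have hmain := minDist_add_le_of_columns (quasiCode K d δ s) (cartPointSplit K s) A
    (by omega) (hκdef ▸ hκ) (quasiCode_column_eq_zero K d δ s A hA)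
  rw [← hκdef, hA, ← hrdef, card_cartPoint, ← hmdef, hJ] at hmain
  have hceil : (κ + r - 1) / r = (κ - 1) / r + 1 := by
    rw [show κ + r - 1 = κ - 1 + r by omega, Nat.add_div_right _ (by omega)]
  have hdiv : r * ((κ - 1) / r) + (κ - 1) % r = κ - 1 := Nat.div_add_mod _ _
  have hcard : (K s).ncard + 1 = r + δ := by omega
  rw [hceil]
  generalize (κ - 1) / r = t at *
  generalize (κ - 1) % r = u at *
  zify [hκ, Nat.one_le_iff_ne_zero.mpr hκ.ne'] at hmain hdiv hcard ⊢
  have hcard' : ((K s).ncard : ℤ) = r + δ - 1 := by linarith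
  rw [hcard'] at hmain
  linarith

end
end QACC
end

section
/- Assume 2 ≤ d_1 ≤ d_2 ≤ ⋯ ≤ d_n and let d̃ := ∑_{i ≠ s}(d_i − 1) + d_s − δ. Then W^(1)(D_X^{(δ,s)}(d̃)) = δ, and this value attains the upper bound m − κ − (⌈κ/r⌉ − 1)(δ − 1) + 1 with κ = dim_{F_q} D_X^{(δ,s)}(d̃) and r = d_s − δ + 1 (i.e. D_X^{(δ,s)}(d̃) is an optimal (r,δ)-locally recoverable code). -/
namespace QACC

open MvPolynomial

noncomputable section

variable {F : Type} [Field F] [Fintype F] [DecidableEq F]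

/-- The restriction of `f` to the line through `x` in direction `s`. -/
def linePoly {n : ℕ} (s : Fin n) (x : Fin n → F) (f : MvPolynomial (Fin n) F) : Polynomial F :=
  aeval (Function.update (fun i => Polynomial.C (x i)) s Polynomial.X) f

theorem eval_linePoly {R : Type} [Field R] {n : ℕ}
    (s : Fin n) (x : Fin n → R) (f : MvPolynomial (Fin n) R) (t : R) :
    (linePoly s x f).eval t = eval (Function.update x s t) f := by
  induction f using MvPolynomial.induction_on with
  | C a => simp [linePoly, Polynomial.algebraMap_eq]
  | add p q hp hq =>
    simp only [linePoly, map_add, Polynomial.eval_add] at hp hq ⊢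
    rw [hp, hq]
  | mul_X p i hp =>
    simp only [linePoly, map_mul, Polynomial.eval_mul, aeval_X, eval_X] at hp ⊢
    rw [hp]
    by_cases h : i = s
    · subst h; simp
    · simp [h]

theorem natDegree_linePoly_le {R : Type} [Field R] {n : ℕ}
    (s : Fin n) (x : Fin n → R) (f : MvPolynomial (Fin n) R) :
    (linePoly s x f).natDegree ≤ f.degreeOf s := by
  rw [linePoly, aeval_def, eval₂_eq']
  refine Polynomial.natDegree_sum_le_of_forall_le _ _ fun e he => ?_
  rw [Polynomial.algebraMap_eq]
  refine (Polynomial.natDegree_C_mul_le _ _).trans ?_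
  refine (Polynomial.natDegree_prod_le _ _).trans ?_
  refine le_trans ?_ (monomial_le_degreeOf s he)
  rw [Finset.sum_eq_single s]
  · simp
  · intro i _ hi
    rw [Function.update_of_ne hi, ← Polynomial.C_pow, Polynomial.natDegree_C]
  · simp

theorem eval_update_eq_zero_s10 {R : Type} [Field R] {n k : ℕ} {s : Fin n} {f : MvPolynomial (Fin n) R}
    (hf : f.degreeOf s ≤ k) (x : Fin n → R) {T : Finset R} (hT : k < T.card)
    (h : ∀ t ∈ T, eval (Function.update x s t) f = 0) (t : R) :
    eval (Function.update x s t) f = 0 := by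
  have h0 : linePoly s x f = 0 :=
    Polynomial.eq_zero_of_natDegree_lt_card_of_eval_eq_zero' _ T
      (fun t ht => by rw [eval_linePoly]; exact h t ht)
      (((natDegree_linePoly_le s x f).trans hf).trans_lt hT)
  rw [← eval_linePoly, h0, Polynomial.eval_zero]

/-- A polynomial vanishing at all points of the box `∏ i, B i` other than `y`. -/
def boxPoly {n : ℕ} (B : Fin n → Finset F) (y : Fin n → F) : MvPolynomial (Fin n) F :=
  ∏ i, ∏ a ∈ (B i).erase (y i), (X i - C a)

theorem eval_boxPoly {R : Type} [Field R] [DecidableEq R] {n : ℕ}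
    (B : Fin n → Finset R) (y x : Fin n → R) :
    eval x (boxPoly B y) = ∏ i, ∏ a ∈ (B i).erase (y i), (x i - a) := by
  simp [boxPoly, map_prod]

theorem eval_boxPoly_self_ne_zero {R : Type} [Field R] [DecidableEq R] {n : ℕ}
    (B : Fin n → Finset R) (y : Fin n → R) :
    eval y (boxPoly B y) ≠ 0 := by
  rw [eval_boxPoly]
  refine Finset.prod_ne_zero_iff.2 fun i _ => Finset.prod_ne_zero_iff.2 fun a ha => ?_
  exact sub_ne_zero.2 (Finset.ne_of_mem_erase ha).symm

theorem eval_boxPoly_eq_zero {R : Type} [Field R] [DecidableEq R] {n : ℕ}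
    (B : Fin n → Finset R) (y x : Fin n → R) {i : Fin n}
    (hi : x i ∈ B i) (hne : x i ≠ y i) : eval x (boxPoly B y) = 0 := by
  rw [eval_boxPoly]
  exact Finset.prod_eq_zero (Finset.mem_univ i)
    (Finset.prod_eq_zero (Finset.mem_erase.2 ⟨hne, hi⟩) (sub_self _))

theorem totalDegree_boxPoly_le {R : Type} [Field R] [DecidableEq R] {n : ℕ}
    (B : Fin n → Finset R) {y : Fin n → R}
    (hy : ∀ i, y i ∈ B i) : (boxPoly B y).totalDegree ≤ ∑ i, ((B i).card - 1) := by
  refine (totalDegree_finsetProd _ _).trans (Finset.sum_le_sum fun i _ => ?_)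
  refine (totalDegree_finsetProd _ _).trans ?_
  rw [← Finset.card_erase_of_mem (hy i), Finset.card_eq_sum_ones]
  refine Finset.sum_le_sum fun a _ => (totalDegree_sub _ _).trans ?_
  simp

theorem degreeOf_boxPoly_le {R : Type} [Field R] [DecidableEq R] {n : ℕ}
    (B : Fin n → Finset R) {y : Fin n → R}
    (hy : ∀ i, y i ∈ B i) (s : Fin n) : (boxPoly B y).degreeOf s ≤ (B s).card - 1 := by
  refine (degreeOf_prod_le _ _ _).trans ?_
  rw [← Finset.card_erase_of_mem (hy s), Finset.card_eq_sum_ones, Finset.sum_eq_single s]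
  · refine (degreeOf_prod_le _ _ _).trans (Finset.sum_le_sum fun a _ => ?_)
    refine (degreeOf_sub_le _ _ _).trans ?_
    simp [degreeOf_C]
  · intro i _ hi
    refine Nat.le_zero.1 ((degreeOf_prod_le _ _ _).trans ?_)
    refine (Finset.sum_le_sum (g := fun _ => 0) fun a _ => ?_).trans (by simp)
    refine (degreeOf_sub_le _ _ _).trans ?_
    simp [degreeOf_C, degreeOf_X, hi.symm]
  · simp

theorem le_hammingNorm_of_mem_quasiCode {n : ℕ} {K : Fin n → Set F} {d δ : ℕ} {s : Fin n}
    (hδs : δ ≤ (K s).ncard) {v : cartPoint K → F} (hv : v ∈ quasiCode K d δ s) (hv0 : v ≠ 0) :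
    δ ≤ hammingNorm v := by
  classical
  obtain ⟨f, ⟨-, hf⟩, rfl⟩ := hv
  obtain ⟨x, hx⟩ := Function.ne_iff.1 hv0
  have hx' : eval (Function.update x.1 s (x.1 s)) f ≠ 0 := by simpa [evalX] using hx
  set L := (K s).toFinset with hL
  have hLc : L.card = (K s).ncard := (Set.ncard_eq_toFinset_card' _).symm
  set Z := L.filter fun t => eval (Function.update x.1 s t) f = 0
  set N := L.filter fun t => ¬ eval (Function.update x.1 s t) f = 0
  have hZ : Z.card ≤ (K s).ncard - δ := by
    by_contra! h
    exact hx' (eval_update_eq_zero_s10 hf x.1 h (fun t ht => (Finset.mem_filter.1 ht).2) _)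
  have hZN : Z.card + N.card = L.card := Finset.card_filter_add_card_filter_not _
  have hN : N.card ≤ hammingNorm (evalX K f) := by
    refine Finset.card_le_card_of_surjOn (fun p : cartPoint K => p.1 s) fun t ht => ?_
    obtain ⟨htL, ht0⟩ := Finset.mem_filter.1 (Finset.mem_coe.1 ht)
    have htK : t ∈ K s := by simpa [hL] using htL
    refine ⟨⟨Function.update x.1 s t, fun i => ?_⟩, Finset.mem_filter.2 ⟨Finset.mem_univ _, ht0⟩,
      by simp⟩
    by_cases h : i = s
    · subst h; simpa using htK
    · simpa [h] using x.2 i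
  omega

/-- The sides of the box obtained from `K` by replacing the `s`-th side with `T`. -/
def boxSides {n : ℕ} (K : Fin n → Set F) (s : Fin n) (T : Finset F) : Fin n → Finset F :=
  Function.update (fun i => (Set.toFinite (K i)).toFinset) s T

section BoxSides

variable {R : Type} [Fintype R] {n : ℕ} {K : Fin n → Set R} {s : Fin n} {T : Finset R}

theorem mem_boxSides_of_ne {i : Fin n} (hi : i ≠ s) {a : R} : a ∈ boxSides K s T i ↔ a ∈ K i := by
  simp [boxSides, hi]

theorem mem_boxSides_self {a : R} : a ∈ boxSides K s T s ↔ a ∈ T := by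
  simp [boxSides]

theorem card_boxSides_of_ne {i : Fin n} (hi : i ≠ s) :
    (boxSides K s T i).card = (K i).ncard := by
  rw [boxSides, Function.update_of_ne hi, ← Set.ncard_eq_toFinset_card]

theorem card_boxSides_self : (boxSides K s T s).card = T.card := by
  simp [boxSides]

theorem mem_of_mem_boxSides (hT : ↑T ⊆ K s) {i : Fin n} {a : R} (ha : a ∈ boxSides K s T i) :
    a ∈ K i := by
  by_cases h : i = s
  · subst h; exact hT (mem_boxSides_self.1 ha)
  · exact (mem_boxSides_of_ne h).1 ha

theorem update_mem_boxSides {t : R} (ht : t ∈ T) {x : Fin n → R} (hx : ∀ i, x i ∈ K i)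
    (i : Fin n) : Function.update x s t i ∈ boxSides K s T i := by
  by_cases h : i = s
  · subst h; simpa using mem_boxSides_self.2 ht
  · simpa [h] using (mem_boxSides_of_ne h).2 (hx i)

end BoxSides

section Box

variable {n : ℕ} {K : Fin n → Set F} {s : Fin n} {T : Finset F}

theorem boxPoly_boxSides_mem_quasiPoly {δ : ℕ} (hT : T.card = (K s).ncard - δ + 1)
    {y : Fin n → F} (hy : ∀ i, y i ∈ boxSides K s T i) :
    boxPoly (boxSides K s T) y ∈ quasiPoly n K
      ((∑ i ∈ Finset.univ.erase s, ((K i).ncard - 1)) + ((K s).ncard - δ)) δ s := by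
  refine ⟨(totalDegree_boxPoly_le _ hy).trans ?_, (degreeOf_boxPoly_le _ hy s).trans ?_⟩
  · rw [← Finset.sum_erase_add _ _ (Finset.mem_univ s), card_boxSides_self, hT,
      Nat.add_sub_cancel]
    refine Nat.add_le_add_right (Finset.sum_le_sum fun i hi => ?_) _
    rw [card_boxSides_of_ne (Finset.ne_of_mem_erase hi)]
  · rw [card_boxSides_self, hT, Nat.add_sub_cancel]

theorem hammingNorm_boxPoly_le (hT : ↑T ⊆ K s) (y : Fin n → F) :
    hammingNorm (evalX K (boxPoly (boxSides K s T) y)) ≤ (K s).ncard - T.card + 1 := by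
  classical
  have hc : ((K s).toFinset \ T).card = (K s).ncard - T.card := by
    rw [Finset.card_sdiff_of_subset (by simpa [← Finset.coe_subset] using hT),
      Set.ncard_eq_toFinset_card']
  rw [← hc]
  refine le_trans ?_ (Finset.card_insert_le (y s) _)
  have key : ∀ p : cartPoint K, evalX K (boxPoly (boxSides K s T) y) p ≠ 0 →
      (∀ i, i ≠ s → p.1 i = y i) ∧ (p.1 s ∈ T → p.1 s = y s) := by
    intro p hp
    refine ⟨fun i hi => ?_, fun hpT => ?_⟩
    · by_contra hne
      exact hp (eval_boxPoly_eq_zero _ _ _ ((mem_boxSides_of_ne hi).2 (p.2 i)) hne)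
    · by_contra hne
      exact hp (eval_boxPoly_eq_zero _ _ _ (mem_boxSides_self.2 hpT) hne)
  refine Finset.card_le_card_of_injOn (fun p : cartPoint K => p.1 s) (fun p hp => ?_) ?_
  · have hp' := key p (Finset.mem_filter.1 (Finset.mem_coe.1 hp)).2
    have := p.2 s
    by_cases h : p.1 s ∈ T
    · simp [hp'.2 h]
    · simp [h, this]
  · intro p hp q hq hpq
    have hp' := key p (Finset.mem_filter.1 (Finset.mem_coe.1 hp)).2
    have hq' := key q (Finset.mem_filter.1 (Finset.mem_coe.1 hq)).2
    ext i
    by_cases h : i = s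
    · subst h; exact hpq
    · rw [hp'.1 i h, hq'.1 i h]

theorem finrank_quasiCode_s10 {δ : ℕ} (hT : ↑T ⊆ K s) (hTc : T.card = (K s).ncard - δ + 1) :
    Module.finrank F (quasiCode K
      ((∑ i ∈ Finset.univ.erase s, ((K i).ncard - 1)) + ((K s).ncard - δ)) δ s) =
      (∏ i ∈ Finset.univ.erase s, (K i).ncard) * T.card := by
  classical
  let Y := {y : Fin n → F // y ∈ Fintype.piFinset (boxSides K s T)}
  have hY : ∀ y : Y, ∀ i, y.1 i ∈ boxSides K s T i := fun y => Fintype.mem_piFinset.1 y.2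
  let ι : Y → cartPoint K := fun y => ⟨y.1, fun i => mem_of_mem_boxSides hT (hY y i)⟩
  let D := quasiCode K
      ((∑ i ∈ Finset.univ.erase s, ((K i).ncard - 1)) + ((K s).ncard - δ)) δ s
  let φ : D →ₗ[F] (Y → F) := (LinearMap.funLeft F F ι).domRestrict D
  have hinj : Function.Injective φ := by
    rw [injective_iff_map_eq_zero]
    rintro ⟨_, f, ⟨_, hf⟩, rfl⟩ hφ
    ext x
    have hzero : ∀ t ∈ T, eval (Function.update x.1 s t) f = 0 := by
      intro t ht
      have hmem : Function.update x.1 s t ∈ Fintype.piFinset (boxSides K s T) :=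
        Fintype.mem_piFinset.2 (update_mem_boxSides ht x.2)
      exact congrFun hφ ⟨_, hmem⟩
    simpa [evalX] using eval_update_eq_zero_s10 hf x.1 (by omega) hzero (x.1 s)
  have hsurj : Function.Surjective φ := by
    rw [← LinearMap.range_eq_top, eq_top_iff, ← (Pi.basisFun F Y).span_eq, Submodule.span_le]
    rintro _ ⟨y, rfl⟩
    let p := boxPoly (boxSides K s T) y.1
    let c := (eval y.1 p)⁻¹
    refine ⟨c • ⟨evalX K p, p, boxPoly_boxSides_mem_quasiPoly hTc (hY y), rfl⟩, ?_⟩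
    ext z
    change c * eval z.1 p = _
    by_cases hzy : z = y
    · subst hzy
      simp [c, p, eval_boxPoly_self_ne_zero]
    · obtain ⟨i, hi⟩ := Function.ne_iff.1 (fun h => hzy (Subtype.ext h))
      rw [eval_boxPoly_eq_zero _ _ _ (hY z i) hi]
      simp [hzy]
  rw [(LinearEquiv.ofBijective φ ⟨hinj, hsurj⟩).finrank_eq, Module.finrank_pi,
    Fintype.card_coe, Fintype.card_piFinset, ← Finset.prod_erase_mul _ _ (Finset.mem_univ s),
    card_boxSides_self]
  congr 1
  exact Finset.prod_congr rfl fun i hi => card_boxSides_of_ne (Finset.ne_of_mem_erase hi)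

end Box

/-- D_X^{(δ,s)}(d̃) has minimum distance δ, and δ attains the upper bound
m - κ - (⌈κ/r⌉ - 1)(δ - 1) + 1, i.e. the code is optimal. -/
theorem quasiCode_dtilde_optimal
    (n : ℕ) (hn : 2 ≤ n) (K : Fin n → Set F) (hK : ∀ i, 2 ≤ (K i).ncard)
    (hmono : Monotone fun i => (K i).ncard)
    (δ : ℕ) (hδ : 2 ≤ δ) (s : Fin n) (hδs : δ ≤ (K s).ncard)
    (dt : ℕ) (hdt : dt = (∑ i ∈ Finset.univ.erase s, ((K i).ncard - 1)) + ((K s).ncard - δ))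
    (r : ℕ) (hrdef : r = (K s).ncard - δ + 1)
    (m : ℕ) (hmdef : m = ∏ i, (K i).ncard)
    (κ : ℕ) (hκdef : κ = Module.finrank F ↥(quasiCode K dt δ s)) :
    minDist (quasiCode K dt δ s) = δ ∧
    (δ : ℤ) = (m : ℤ) - (κ : ℤ) - ((((κ + r - 1) / r : ℕ) : ℤ) - 1) * ((δ : ℤ) - 1) + 1 := by
  classical
  obtain ⟨T, hT, hTc⟩ :=
    Set.exists_subset_card_eq (s := K s) (n := (K s).ncard - δ + 1) (by omega)
  lift T to Finset F using T.toFinite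
  rw [Set.ncard_coe_finset] at hTc
  subst hdt
  constructor
  · have hne : ∀ i, (K i).Nonempty := fun i =>
      Set.nonempty_of_ncard_ne_zero (by have := hK i; omega)
    choose y₀ hy₀ using hne
    obtain ⟨t, ht⟩ : T.Nonempty := Finset.card_pos.1 (by omega)
    have hy : ∀ i, Function.update y₀ s t i ∈ boxSides K s T i := update_mem_boxSides ht hy₀
    set y := Function.update y₀ s t
    set v := evalX K (boxPoly (boxSides K s T) y)
    have hmem : v ∈ quasiCode K
        ((∑ i ∈ Finset.univ.erase s, ((K i).ncard - 1)) + ((K s).ncard - δ)) δ s :=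
      ⟨_, boxPoly_boxSides_mem_quasiPoly hTc hy, rfl⟩
    have hv0 : v ≠ 0 := fun h => eval_boxPoly_self_ne_zero (boxSides K s T) y
      (congrFun h ⟨y, fun i => mem_of_mem_boxSides hT (hy i)⟩)
    have hle : hammingNorm v ≤ δ := (hammingNorm_boxPoly_le hT y).trans (by omega)
    refine le_antisymm (le_trans (Nat.sInf_le ⟨v, hmem, hv0, rfl⟩) hle) ?_
    refine le_csInf ⟨hammingNorm v, v, hmem, hv0, rfl⟩ ?_
    rintro _ ⟨w, hw, hw0, rfl⟩
    exact le_hammingNorm_of_mem_quasiCode hδs hw hw0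
  · rw [finrank_quasiCode_s10 hT hTc, hTc, ← hrdef] at hκdef
    rw [← Finset.prod_erase_mul _ _ (Finset.mem_univ s)] at hmdef
    set P := ∏ i ∈ Finset.univ.erase s, (K i).ncard
    have hceil : (κ + r - 1) / r = P := by
      rw [hκdef, Nat.add_sub_assoc (by omega), Nat.add_comm, Nat.add_mul_div_right _ _ (by omega),
        Nat.div_eq_of_lt (by omega), zero_add]
    have hr : (r : ℤ) = (K s).ncard - δ + 1 := by omega
    rw [hceil, hκdef, hmdef]
    push_cast
    rw [hr]
    ring

end
end QACC
end

section
/- Let K_1 ⊆ K_2 ⊆ ⋯ ⊆ K_n ⊆ F_q be subfields of the finite field F_q and X = K_1 × ⋯ × K_n. Let ψ : F_q^n → F_q^n be the affine transformation α ↦ Aα + β with A = (a_{ij}) ∈ GL(n, F_q) and β = (b_1,…,b_n) ∈ F_q^n. Then ψ(X) = X if and only if both of the following hold: (i) for all i, j ∈ {1,…,n}, a_{ij} ∈ K_i, b_j ∈ K_j, and a_{ij} = 0 whenever K_i ⊊ K_j; (ii) for all i ≤ j in {1,…,n} such that K_{i−1} ⊊ K_i = K_j ⊊ K_{j+1} (with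 the conventions that the condition K_{i−1} ⊊ K_i is vacuously true when i = 1 and K_j ⊊ K_{j+1} is vacuously true when j = n), the square submatrix (a_{uw})_{i ≤ u,w ≤ j} is invertible. -/
namespace QACC

open MvPolynomial

noncomputable section

variable {F : Type} [Field F] [Fintype F] [DecidableEq F]

omit [Fintype F] [DecidableEq F] in
theorem mulVec_add_mem {n : ℕ} {K : Fin n → Subfield F} (hmono : Monotone K)
    {A : Matrix (Fin n) (Fin n) F} {b : Fin n → F}
    (h : ∀ i j : Fin n, A i j ∈ K i ∧ b j ∈ K j ∧ (K i < K j → A i j = 0))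
    {α : Fin n → F} (hα : ∀ i, α i ∈ K i) (i : Fin n) : (A.mulVec α + b) i ∈ K i := by
  refine add_mem (show ∑ j, A i j * α j ∈ K i from sum_mem fun j _ => ?_) (h i i).2.1
  rcases ((le_total i j).imp (@hmono i j) (@hmono j i) : K i ≤ K j ∨ K j ≤ K i) with hij | hji
  · rcases hij.eq_or_lt with heq | hlt
    · exact mul_mem (h i j).1 (heq ▸ hα j)
    · simp [(h i j).2.2 hlt]
  · exact mul_mem (h i j).1 (hji (hα j))

omit [Fintype F] in
theorem entries_mem_of_mapsTo {n : ℕ} {K : Fin n → Subfield F}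
    {A : Matrix (Fin n) (Fin n) F} {b : Fin n → F}
    (h : ∀ α : Fin n → F, (∀ i, α i ∈ K i) → ∀ i, (A.mulVec α + b) i ∈ K i) (i j : Fin n) :
    A i j ∈ K i ∧ b j ∈ K j ∧ (K i < K j → A i j = 0) := by
  have hb : ∀ k, b k ∈ K k := fun k => by
    simpa using h 0 (fun k => zero_mem (K k)) k
  have hmul : ∀ c ∈ K j, A i j * c ∈ K i := fun c hc => by
    have hmem := h (Pi.single j c) (fun k => by
      rcases eq_or_ne k j with rfl | hk
      · simpa using hc
      · simp [hk]) i
    have hsub := sub_mem hmem (hb i)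
    simpa [mul_comm] using hsub
  have hA : A i j ∈ K i := by simpa using hmul 1 (one_mem _)
  refine ⟨hA, hb j, fun hlt => ?_⟩
  obtain ⟨c, hcj, hci⟩ := SetLike.exists_of_lt hlt
  by_contra hne
  refine hci ?_
  have hquot := mul_mem (inv_mem hA) (hmul c hcj)
  rwa [inv_mul_cancel_left₀ hne] at hquot

omit [Fintype F] [DecidableEq F] in
theorem eq_iff_mem_maximal_interval {n : ℕ} {K : Fin n → Subfield F} (hmono : Monotone K)
    {i j : Fin n}
    (hi : ∀ i' : Fin n, (i' : ℕ) + 1 = (i : ℕ) → K i' < K i)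
    (hij : K i = K j)
    (hj : ∀ j' : Fin n, (j : ℕ) + 1 = (j' : ℕ) → K j < K j') (u : Fin n) :
    K u = K i ↔ i ≤ u ∧ u ≤ j := by
  constructor
  · intro hu
    constructor
    · by_contra! hlt
      have hlt' : (u : ℕ) < i := hlt
      have hpred := hi ⟨(i : ℕ) - 1, by omega⟩ (by simp only; omega)
      have hle : K u ≤ K ⟨(i : ℕ) - 1, by omega⟩ := hmono (Fin.le_def.2 (by simp only; omega))
      exact (hle.trans_lt hpred).ne hu
    · by_contra! hlt
      have hlt' : (j : ℕ) < u := hlt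
      have hsucc := hj ⟨(j : ℕ) + 1, by omega⟩ rfl
      have hle : K ⟨(j : ℕ) + 1, by omega⟩ ≤ K u := hmono (Fin.le_def.2 (by simp only; omega))
      exact (hsucc.trans_le hle).ne (hij.symm.trans hu.symm)
  · rintro ⟨hiu, huj⟩
    exact le_antisymm ((hmono huj).trans hij.ge) (hmono hiu)

omit [DecidableEq F] in
theorem natCard_lt_of_lt {L M : Subfield F} (h : L < M) : Nat.card L < Nat.card M :=
  Set.ncard_lt_ncard (SetLike.coe_ssubset_coe.2 h) (Set.toFinite _)

omit [DecidableEq F] in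
theorem lt_of_natCard_lt {n : ℕ} {K : Fin n → Subfield F} (hmono : Monotone K) {i j : Fin n}
    (h : Nat.card (K i) < Nat.card (K j)) : K i < K j := by
  rcases le_total i j with hij | hji
  · exact (hmono hij).lt_of_ne fun heq => h.ne (by rw [heq])
  · rcases (hmono hji).eq_or_lt with heq | hlt
    · exact absurd h (by rw [heq]; exact lt_irrefl _)
    · exact absurd h (natCard_lt_of_lt hlt).not_gt

omit [DecidableEq F] in
theorem natCard_eq_iff {n : ℕ} {K : Fin n → Subfield F} (hmono : Monotone K) (i j : Fin n) :
    Nat.card (K i) = Nat.card (K j) ↔ K i = K j := by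
  refine ⟨fun h => ?_, fun h => by rw [h]⟩
  rcases le_total i j with hij | hji
  · exact (hmono hij).eq_of_not_lt fun hlt => (natCard_lt_of_lt hlt).ne h
  · exact ((hmono hji).eq_of_not_lt fun hlt => (natCard_lt_of_lt hlt).ne h.symm).symm

omit [DecidableEq F] in
theorem isUnit_det_of_forall_eq_zero {n : ℕ} {K : Fin n → Subfield F} (hmono : Monotone K)
    {A : Matrix (Fin n) (Fin n) F} (hA : IsUnit A.det)
    (hzero : ∀ i j, K i < K j → A i j = 0) {p : Fin n → Prop} [DecidablePred p] (i : Fin n)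
    (hp : ∀ u, K u = K i ↔ p u) :
    IsUnit (A.submatrix (fun u : {u // p u} => u.1) (fun u : {u // p u} => u.1)).det := by
  let c : Fin n → ℕᵒᵈ := fun u => OrderDual.toDual (Nat.card (K u))
  have htri : A.BlockTriangular c := fun u v huv =>
    hzero u v (lt_of_natCard_lt hmono (OrderDual.toDual_lt_toDual.1 huv))
  rw [htri.det, isUnit_iff_ne_zero, Finset.prod_ne_zero_iff] at hA
  have hblock := hA (c i) (Finset.mem_image_of_mem c (Finset.mem_univ i))
  have hpc : ∀ u, p u ↔ c u = c i := fun u => by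
    rw [← hp u, ← natCard_eq_iff hmono]
    exact OrderDual.toDual_inj.symm
  rw [isUnit_iff_ne_zero]
  rw [← Matrix.det_submatrix_equiv_self (Equiv.subtypeEquivRight hpc)] at hblock
  exact hblock

/-- for a chain of subfields K_1 ⊆ ⋯ ⊆ K_n of F_q, the affine map
α ↦ Aα + b maps X = K_1 × ⋯ × K_n onto itself iff conditions (i) and (ii) hold.
(The vacuous conventions at i = 1 and j = n are expressed by quantifying over a
predecessor i' with i' + 1 = i, resp. a successor j' with j + 1 = j'.) -/
theorem affine_maps_cartesian_set_iff
    (n : ℕ) (K : Fin n → Subfield F) (hmono : Monotone K)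
    (A : Matrix (Fin n) (Fin n) F) (hA : IsUnit A.det) (b : Fin n → F) :
    (fun α => A.mulVec α + b) '' {α : Fin n → F | ∀ i, α i ∈ K i}
        = {α : Fin n → F | ∀ i, α i ∈ K i} ↔
    ((∀ i j : Fin n, A i j ∈ K i ∧ b j ∈ K j ∧ (K i < K j → A i j = 0)) ∧
     (∀ i j : Fin n, i ≤ j →
        (∀ i' : Fin n, (i' : ℕ) + 1 = (i : ℕ) → K i' < K i) →
        K i = K j →
        (∀ j' : Fin n, (j : ℕ) + 1 = (j' : ℕ) → K j < K j') →
        IsUnit (A.submatrix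
            (fun u : {u : Fin n // i ≤ u ∧ u ≤ j} => u.1)
            (fun u : {u : Fin n // i ≤ u ∧ u ≤ j} => u.1)).det)) := by
  constructor
  · intro h
    have hentries : ∀ i j : Fin n, A i j ∈ K i ∧ b j ∈ K j ∧ (K i < K j → A i j = 0) :=
      entries_mem_of_mapsTo fun α hα => h.subset ⟨α, hα, rfl⟩
    exact ⟨hentries, fun i j _ hi hij hj => isUnit_det_of_forall_eq_zero hmono hA
      (fun u v => (hentries u v).2.2) i (eq_iff_mem_maximal_interval hmono hi hij hj)⟩
  · rintro ⟨hentries, -⟩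
    refine Set.eq_of_subset_of_ncard_le ?_ (Set.ncard_image_of_injective _ ?_).ge (Set.toFinite _)
    · rintro _ ⟨α, hα, rfl⟩
      exact mulVec_add_mem hmono hentries hα
    · exact (add_left_injective b).comp
        (Matrix.mulVec_injective_of_isUnit ((Matrix.isUnit_iff_isUnit_det A).2 hA))

end
end QACC
end
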